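/- For every nontrivial periodic wave in 𝒲 \ 𝒲₀ (that is, a nontrivial wave in 𝒲 with u_x > 0 somewhere on S⁺), the infimum over Ω⁺ of u_x/u is strictly negative and is attained at some point z₀ = (x₀, η(x₀)) ∈ S⁺ with 0 < x₀ < L, and at this point z₀ the inequality g(u⁴ − 4u²v² − v⁴) − γ(0)·u³(u² + 5v²) < 0 holds. -/

import Mathlib

open Set

/-- Partial derivative in the horizontal direction. -/
noncomputable def pdX (f : ℝ × ℝ → ℝ) (p : ℝ × ℝ) : ℝ := fderiv ℝ f p (1, 0)

/-- Partial derivative in the vertical direction. -/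
noncomputable def pdY (f : ℝ × ℝ → ℝ) (p : ℝ × ℝ) : ℝ := fderiv ℝ f p (0, 1)

/-- A symmetric `2L`-periodic steady gravity water wave with vorticity, in the frame
moving with the wave.  The fluid occupies `Ω = {(x,y) : -L < x < L, -d < y < η x}`;
`u, v` are the relative velocity components, `P` is the pressure, `η` the surface
profile, `ψ` the stream function and `γ` the vorticity function. -/
structure PeriodicWave (g Patm L : ℝ) : Type where
  u : ℝ × ℝ → ℝ
  v : ℝ × ℝ → ℝ
  P : ℝ × ℝ → ℝ
  η : ℝ → ℝ
  ψ : ℝ × ℝ → ℝ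
  γ : ℝ → ℝ
  d : ℝ
  m : ℝ
  d_pos : 0 < d
  m_pos : 0 < m
  u_smooth : ContDiff ℝ 3 u
  v_smooth : ContDiff ℝ 3 v
  P_smooth : ContDiff ℝ 3 P
  η_smooth : ContDiff ℝ 4 η
  ψ_smooth : ContDiff ℝ 4 ψ
  γ_smooth : ContDiffOn ℝ 2 γ (Icc 0 m)
  u_periodic : ∀ x y, u (x + 2 * L, y) = u (x, y)
  v_periodic : ∀ x y, v (x + 2 * L, y) = v (x, y)
  P_periodic : ∀ x y, P (x + 2 * L, y) = P (x, y)
  η_periodic : ∀ x, η (x + 2 * L) = η x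
  η_mean : (∫ x in (-L)..L, η x) = 0
  u_even : ∀ x y, u (-x, y) = u (x, y)
  v_odd : ∀ x y, v (-x, y) = -v (x, y)
  P_even : ∀ x y, P (-x, y) = P (x, y)
  η_even : ∀ x, η (-x) = η x
  euler_x : ∀ x y, -d < y → y < η x →
    u (x, y) * pdX u (x, y) + v (x, y) * pdY u (x, y) = -pdX P (x, y)
  euler_y : ∀ x y, -d < y → y < η x →
    u (x, y) * pdX v (x, y) + v (x, y) * pdY v (x, y) = -(pdY P (x, y)) - g
  incompressible : ∀ x y, -d < y → y < η x → pdX u (x, y) + pdY v (x, y) = 0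
  surface_pressure : ∀ x, P (x, η x) = Patm
  surface_kinematic : ∀ x, v (x, η x) = deriv η x * u (x, η x)
  bed_kinematic : ∀ x, v (x, -d) = 0
  nonstagnant : ∃ δ > 0, ∀ x y, -d ≤ y → y ≤ η x → u (x, y) ≤ -δ
  psi_x : ∀ x y, -d ≤ y → y ≤ η x → pdX ψ (x, y) = -v (x, y)
  psi_y : ∀ x y, -d ≤ y → y ≤ η x → pdY ψ (x, y) = u (x, y)
  psi_surface : ∀ x, ψ (x, η x) = 0
  psi_bed : ∀ x, ψ (x, -d) = m
  vorticity_eq : ∀ x y, -d < y → y < η x → pdX v (x, y) - pdY u (x, y) = γ (ψ (x, y))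

namespace PeriodicWave

variable {g Patm L : ℝ}

/-- The closure of one period `Ω` of the fluid domain. -/
def Ωbar (W : PeriodicWave g Patm L) : Set (ℝ × ℝ) :=
  {p | -L ≤ p.1 ∧ p.1 ≤ L ∧ -W.d ≤ p.2 ∧ p.2 ≤ W.η p.1}

/-- The open half period `Ω⁺` of the fluid domain. -/
def Ωplus (W : PeriodicWave g Patm L) : Set (ℝ × ℝ) :=
  {p | 0 < p.1 ∧ p.1 < L ∧ -W.d < p.2 ∧ p.2 < W.η p.1}

/-- The half period `S⁺` of the free surface. -/
def Splus (W : PeriodicWave g Patm L) : Set (ℝ × ℝ) :=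
  {p | 0 < p.1 ∧ p.1 < L ∧ p.2 = W.η p.1}

/-- A wave is trivial if `u, v, P, η` depend only on `y`. -/
def IsTrivial (W : PeriodicWave g Patm L) : Prop :=
  (∀ p, W.v p = 0) ∧ (∀ x, W.η x = 0) ∧
    (∀ x x' y, W.u (x, y) = W.u (x', y)) ∧ (∀ x x' y, W.P (x, y) = W.P (x', y))

/-- The streamline monotonicity condition `v > 0` on `Ω⁺ ∪ S⁺`. -/
def MonotoneHalf (W : PeriodicWave g Patm L) : Prop :=
  ∀ p ∈ W.Ωplus ∪ W.Splus, 0 < W.v p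

/-- Membership in the water-wave set 𝒲 : the vorticity function satisfies
`γ ≤ 0`, `γ' ≤ 0`, `γ'' ≤ 0` on `[0, m]`, and the wave is either trivial or
monotone. -/
def MemW (W : PeriodicWave g Patm L) : Prop :=
  (∀ s ∈ Icc (0:ℝ) W.m, W.γ s ≤ 0) ∧
  (∀ s ∈ Icc (0:ℝ) W.m, derivWithin W.γ (Icc 0 W.m) s ≤ 0) ∧
  (∀ s ∈ Icc (0:ℝ) W.m, derivWithin (derivWithin W.γ (Icc 0 W.m)) (Icc 0 W.m) s ≤ 0) ∧
  (W.IsTrivial ∨ W.MonotoneHalf)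

/-- The trace of `(u, v, u_x, v_x, u_y, u_xx, u_xy)` on the free surface. -/
noncomputable def trace (W : PeriodicWave g Patm L) (x : ℝ) :
    ℝ × ℝ × ℝ × ℝ × ℝ × ℝ × ℝ :=
  (W.u (x, W.η x), W.v (x, W.η x), pdX W.u (x, W.η x), pdX W.v (x, W.η x),
    pdY W.u (x, W.η x), pdX (pdX W.u) (x, W.η x), pdY (pdX W.u) (x, W.η x))

end PeriodicWave


/-! ### Partial derivatives -/

lemma pdX_hasDerivAt {f : ℝ × ℝ → ℝ} {x y : ℝ} (hf : DifferentiableAt ℝ f (x, y)) :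
    HasDerivAt (fun t => f (t, y)) (pdX f (x, y)) x := by
  have h : HasDerivAt (fun t : ℝ => (t, y)) ((1 : ℝ), (0 : ℝ)) x :=
    (hasDerivAt_id x).prodMk (hasDerivAt_const x y)
  exact HasFDerivAt.comp_hasDerivAt (f := fun t : ℝ => (t, y)) x hf.hasFDerivAt h

lemma pdY_hasDerivAt {f : ℝ × ℝ → ℝ} {x y : ℝ} (hf : DifferentiableAt ℝ f (x, y)) :
    HasDerivAt (fun t => f (x, t)) (pdY f (x, y)) y := by
  have h : HasDerivAt (fun t : ℝ => (x, t)) ((0 : ℝ), (1 : ℝ)) y :=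
    (hasDerivAt_const y x).prodMk (hasDerivAt_id y)
  exact HasFDerivAt.comp_hasDerivAt (f := fun t : ℝ => (x, t)) y hf.hasFDerivAt h

lemma pd_hasDerivAt_graph {f : ℝ × ℝ → ℝ} {η : ℝ → ℝ} {x η' : ℝ}
    (hf : DifferentiableAt ℝ f (x, η x)) (hη : HasDerivAt η η' x) :
    HasDerivAt (fun t => f (t, η t)) (pdX f (x, η x) + η' * pdY f (x, η x)) x := by
  have h : HasDerivAt (fun t : ℝ => (t, η t)) ((1 : ℝ), η') x := (hasDerivAt_id x).prodMk hη
  have h2 := HasFDerivAt.comp_hasDerivAt (f := fun t : ℝ => (t, η t)) x hf.hasFDerivAt h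
  have : ((1 : ℝ), η') = (1, 0) + η' • ((0 : ℝ), (1 : ℝ)) := by simp
  rw [this, map_add, map_smul] at h2
  exact h2

lemma ContDiff.pdX {f : ℝ × ℝ → ℝ} {n m : WithTop ℕ∞} (hf : ContDiff ℝ n f) (h : m + 1 ≤ n) :
    ContDiff ℝ m (pdX f) :=
  (hf.fderiv_right h).clm_apply contDiff_const

lemma ContDiff.pdY {f : ℝ × ℝ → ℝ} {n m : WithTop ℕ∞} (hf : ContDiff ℝ n f) (h : m + 1 ≤ n) :
    ContDiff ℝ m (pdY f) :=
  (hf.fderiv_right h).clm_apply contDiff_const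

lemma pdX_pdY_comm {f : ℝ × ℝ → ℝ} (hf : ContDiff ℝ 2 f) : pdX (pdY f) = pdY (pdX f) := by
  funext p
  have hs : IsSymmSndFDerivAt ℝ f p := hf.contDiffAt.isSymmSndFDerivAt (by simp)
  have hd : DifferentiableAt ℝ (fderiv ℝ f) p :=
    (hf.fderiv_right (m := 1) (by norm_num)).differentiable (by norm_num) p
  have key : ∀ a b : ℝ × ℝ,
      fderiv ℝ (fun q => fderiv ℝ f q a) p b = fderiv ℝ (fderiv ℝ f) p b a := by
    intro a b
    rw [fderiv_clm_apply hd (differentiableAt_const a)]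
    simp
  exact (key _ _).trans ((hs _ _).trans (key _ _).symm)

lemma pdX_eq_of_eventuallyEq {f : ℝ × ℝ → ℝ} {h : ℝ → ℝ} {x y c : ℝ}
    (hf : DifferentiableAt ℝ f (x, y)) (he : ∀ᶠ t in nhds x, f (t, y) = h t)
    (hh : HasDerivAt h c x) : pdX f (x, y) = c :=
  (pdX_hasDerivAt hf).unique (hh.congr_of_eventuallyEq he)

lemma pdY_eq_of_eventuallyEq {f : ℝ × ℝ → ℝ} {h : ℝ → ℝ} {x y c : ℝ}
    (hf : DifferentiableAt ℝ f (x, y)) (he : ∀ᶠ t in nhds y, f (x, t) = h t)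
    (hh : HasDerivAt h c y) : pdY f (x, y) = c :=
  (pdY_hasDerivAt hf).unique (hh.congr_of_eventuallyEq he)

/-- Second-order necessary condition at a local maximum. -/
lemma IsLocalMax.second_deriv_nonpos {w w₁ : ℝ → ℝ} {x w₂ : ℝ} (hm : IsLocalMax w x)
    (h1 : ∀ t, HasDerivAt w (w₁ t) t) (h2 : HasDerivAt w₁ w₂ x) : w₂ ≤ 0 := by
  by_contra! hpos
  have hd : deriv w = w₁ := funext fun t => (h1 t).deriv
  have hmin : IsLocalMin w x := by
    apply isLocalMin_of_deriv_deriv_pos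
    · rw [hd, h2.deriv]; exact hpos
    · exact hm.deriv_eq_zero
    · exact (h1 x).continuousAt
  have hc : w =ᶠ[nhds x] fun _ => w x := by
    filter_upwards [hm, hmin] with t ha hb using le_antisymm ha hb
  have : deriv (deriv w) x = 0 := by
    rw [hc.deriv.deriv_eq]
    simp
  rw [hd, h2.deriv] at this
  exact hpos.ne' this

/-- If `f ≥ f(b)` to the left of `b`, then `f'(b) ≤ 0`. -/
lemma HasDerivAt.nonpos_of_le_left {f : ℝ → ℝ} {a b f' : ℝ} (hf : HasDerivAt f f' b) (hab : a < b)
    (h : ∀ t, a < t → t < b → f b ≤ f t) : f' ≤ 0 := by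
  have ht := (hasDerivAt_iff_tendsto_slope.1 hf).mono_left
    (nhdsWithin_mono b (fun t (ht : t < b) => ht.ne) : nhdsWithin b (Iio b) ≤ _)
  refine le_of_tendsto ht ?_
  filter_upwards [Ioo_mem_nhdsLT hab] with t ht
  rw [slope_def_field]
  exact div_nonpos_of_nonneg_of_nonpos (sub_nonneg.2 (h t ht.1 ht.2)) (sub_nonpos.2 ht.2.le)

/-- If `f ≥ f(a)` to the right of `a`, then `f'(a) ≥ 0`. -/
lemma HasDerivAt.nonneg_of_le_right {f : ℝ → ℝ} {a b f' : ℝ} (hf : HasDerivAt f f' a) (hab : a < b)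
    (h : ∀ t, a < t → t < b → f a ≤ f t) : 0 ≤ f' := by
  have ht := (hasDerivAt_iff_tendsto_slope.1 hf).mono_left
    (nhdsWithin_mono a (fun t (ht : a < t) => ht.ne') : nhdsWithin a (Ioi a) ≤ _)
  refine ge_of_tendsto ht ?_
  filter_upwards [Ioo_mem_nhdsGT hab] with t ht
  rw [slope_def_field]
  exact div_nonneg (sub_nonneg.2 (h t ht.1 ht.2)) (sub_nonneg.2 ht.1.le)

/-- The algebraic inequality at a surface minimum of `u_x / u`.  Here `a, b` stand for
`u_x, u_y`, and `A, B, C` for `u_xx, u_xy, u_yy`. -/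
lemma surface_algebra {g γ u v a b A B C : ℝ} (hg : 0 < g) (hγ : γ ≤ 0) (hu : u < 0) (hv : 0 < v)
    (ha : 0 < a)
    (h1 : (u ^ 2 - v ^ 2) * a + 2 * u * v * b + v * (g + γ * u) = 0)
    (h2 : u * (A * u - a ^ 2) + v * (B * u - a * b) = 0)
    (h3 : (u ^ 2 - v ^ 2) * (u * A + v * B) + 2 * u * v * (u * B + v * C)
      + a * (2 * u * (u * a + v * b) - 2 * v * (u * (b + γ) - v * a))
      + 2 * b * (v * (u * a + v * b) + u * (u * (b + γ) - v * a))
      + (g + γ * u) * (u * (b + γ) - v * a) + γ * v * (u * a + v * b) = 0)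
    (hN : B * u - a * b ≤ 0) (hC : A + C ≤ 0) :
    g * (u ^ 4 - 4 * u ^ 2 * v ^ 2 - v ^ 4) - γ * u ^ 3 * (u ^ 2 + 5 * v ^ 2) < 0 := by
  have hu0 : u ≠ 0 := hu.ne
  obtain ⟨t, rfl⟩ : ∃ t, a = v * t := ⟨a / v, by field_simp⟩
  have ht : 0 < t := pos_of_mul_pos_right ha hv.le
  obtain ⟨n, hn⟩ : ∃ n, n = B * u - v * t * b := ⟨_, rfl⟩
  obtain ⟨c, hc⟩ : ∃ c, c = A + C := ⟨_, rfl⟩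
  rw [← hn] at hN h2
  rw [← hc] at hC
  have hb : b = -((g + γ * u) + (u ^ 2 - v ^ 2) * t) / (2 * u) := by
    have : v * ((u ^ 2 - v ^ 2) * t + 2 * u * b + (g + γ * u)) = 0 := by linear_combination h1
    have := (mul_eq_zero.1 this).resolve_left hv.ne'
    field_simp
    linear_combination this
  have hB : B = (n + v * t * b) / u := by
    field_simp
    linear_combination -hn
  have hA : A = ((v * t) ^ 2 - v * n / u) / u := by
    field_simp
    linear_combination h2
  have hCC : C = c - A := by linear_combination -hc
  have key : (u ^ 2 + v ^ 2) ^ 2 * u ^ 2 * t ^ 2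
      + (g * (u ^ 4 - 4 * u ^ 2 * v ^ 2 - v ^ 4) - γ * u ^ 3 * (u ^ 2 + 5 * v ^ 2)) * t
      + g * v ^ 2 * (g + γ * u) + 4 * u ^ 3 * v ^ 2 * c
      + 4 * u * v * (u ^ 2 + v ^ 2) * n = 0 := by
    subst hCC
    rw [hA, hB, hb] at h3
    field_simp at h3
    linear_combination h3
  have hk : 0 ≤ γ * u := mul_nonneg_of_nonpos_of_nonpos hγ hu.le
  have e1 : 0 ≤ u * c := mul_nonneg_of_nonpos_of_nonpos hu.le hC
  have e2 : 0 ≤ u * n := mul_nonneg_of_nonpos_of_nonpos hu.le hN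
  have e3 : 0 ≤ u ^ 2 * v ^ 2 * (u * c) := by positivity
  have e4 : 0 ≤ v * (u ^ 2 + v ^ 2) * (u * n) := by positivity
  have e5 : 0 < g * v ^ 2 * (g + γ * u) := by positivity
  have e6 : 0 ≤ (u ^ 2 + v ^ 2) ^ 2 * u ^ 2 * t ^ 2 := by positivity
  by_contra! hcon
  have := mul_nonneg hcon ht.le
  nlinarith

lemma nonneg_of_nonneg_Ioo {F : ℝ → ℝ} {a b : ℝ} (hF : Continuous F) (hab : a < b)
    (h : ∀ y, a < y → y < b → 0 ≤ F y) {y : ℝ} (hy : y ∈ Icc a b) : 0 ≤ F y := by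
  rw [← closure_Ioo hab.ne] at hy
  exact closure_minimal (fun z hz => h z hz.1 hz.2) (isClosed_le continuous_const hF) hy

lemma eq_zero_of_eq_zero_Ioo {F : ℝ → ℝ} {a b : ℝ} (hF : Continuous F) (hab : a < b)
    (h : ∀ y, a < y → y < b → F y = 0) {y : ℝ} (hy : y ∈ Icc a b) : F y = 0 :=
  le_antisymm
    (neg_nonneg.1 (nonneg_of_nonneg_Ioo hF.neg hab (fun z h1 h2 => by simp [h z h1 h2]) hy))
    (nonneg_of_nonneg_Ioo hF hab (fun z h1 h2 => (h z h1 h2).ge) hy)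

namespace PeriodicWave

variable {g Patm L : ℝ} (W : PeriodicWave g Patm L)

lemma differentiable_u : Differentiable ℝ W.u := W.u_smooth.differentiable (by norm_num)
lemma differentiable_v : Differentiable ℝ W.v := W.v_smooth.differentiable (by norm_num)
lemma differentiable_P : Differentiable ℝ W.P := W.P_smooth.differentiable (by norm_num)
lemma differentiable_ψ : Differentiable ℝ W.ψ := W.ψ_smooth.differentiable (by norm_num)
lemma differentiable_η : Differentiable ℝ W.η := W.η_smooth.differentiable (by norm_num)
lemma contDiff_pdX_u : ContDiff ℝ 2 (pdX W.u) := W.u_smooth.pdX (by norm_num)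
lemma contDiff_pdY_u : ContDiff ℝ 2 (pdY W.u) := W.u_smooth.pdY (by norm_num)
lemma contDiff_pdX_v : ContDiff ℝ 2 (pdX W.v) := W.v_smooth.pdX (by norm_num)
lemma contDiff_pdY_v : ContDiff ℝ 2 (pdY W.v) := W.v_smooth.pdY (by norm_num)
lemma contDiff_pdX_pdX_u : ContDiff ℝ 1 (pdX (pdX W.u)) := W.contDiff_pdX_u.pdX (by norm_num)
lemma contDiff_pdY_pdX_u : ContDiff ℝ 1 (pdY (pdX W.u)) := W.contDiff_pdX_u.pdY (by norm_num)
lemma contDiff_pdY_pdY_u : ContDiff ℝ 1 (pdY (pdY W.u)) := W.contDiff_pdY_u.pdY (by norm_num)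

lemma u_neg {x y : ℝ} (h1 : -W.d ≤ y) (h2 : y ≤ W.η x) : W.u (x, y) < 0 := by
  obtain ⟨δ, hδ, h⟩ := W.nonstagnant
  linarith [h x y h1 h2]

/-- The surface lies strictly above the bed. -/
lemma neg_d_lt_η (hL : 0 < L) (x : ℝ) : -W.d < W.η x := by
  have hne : ∀ x, W.η x ≠ -W.d := by
    intro x hx
    have h1 := W.psi_surface x
    rw [hx, W.psi_bed x] at h1
    exact W.m_pos.ne' h1
  have hc : Continuous W.η := W.η_smooth.continuous
  obtain ⟨x₁, hx₁⟩ : ∃ x₁, -W.d < W.η x₁ := by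
    by_contra! hcon
    have h := intervalIntegral.integral_mono_on (μ := MeasureTheory.volume) (a := -L) (b := L) (by linarith)
      (hc.intervalIntegrable _ _) (continuous_const.intervalIntegrable _ _) (fun t _ => hcon t)
    rw [W.η_mean, intervalIntegral.integral_const, smul_eq_mul] at h
    nlinarith [W.d_pos, mul_pos hL W.d_pos]
  by_contra! hx
  obtain ⟨z, hz⟩ := mem_range_of_exists_le_of_exists_ge hc ⟨x, hx⟩ ⟨x₁, hx₁.le⟩
  exact hne z hz

lemma psi_strictAntiOn (x : ℝ) : StrictAntiOn (fun y => W.ψ (x, y)) (Icc (-W.d) (W.η x)) := by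
  apply strictAntiOn_of_deriv_neg (convex_Icc _ _)
  · exact (W.ψ_smooth.continuous.comp (by fun_prop)).continuousOn
  · intro y hy
    rw [interior_Icc] at hy
    rw [(pdY_hasDerivAt (W.differentiable_ψ _)).deriv, W.psi_y x y hy.1.le hy.2.le]
    exact W.u_neg hy.1.le hy.2.le

lemma psi_mem_Ioo {x y : ℝ} (h1 : -W.d < y) (h2 : y < W.η x) : W.ψ (x, y) ∈ Ioo 0 W.m := by
  have hlt := h1.trans h2
  constructor
  · have := W.psi_strictAntiOn x ⟨h1.le, h2.le⟩ (right_mem_Icc.2 hlt.le) h2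
    simpa [W.psi_surface] using this
  · have := W.psi_strictAntiOn x (left_mem_Icc.2 hlt.le) ⟨h1.le, h2.le⟩ h1
    simpa [W.psi_bed] using this

lemma psi_mem_Icc {x y : ℝ} (h1 : -W.d ≤ y) (h2 : y ≤ W.η x) : W.ψ (x, y) ∈ Icc 0 W.m := by
  have hlt := h1.trans h2
  constructor
  · have := (W.psi_strictAntiOn x).antitoneOn ⟨h1, h2⟩ (right_mem_Icc.2 hlt) h2
    simpa [W.psi_surface] using this
  · have := (W.psi_strictAntiOn x).antitoneOn (left_mem_Icc.2 hlt) ⟨h1, h2⟩ h1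
    simpa [W.psi_bed] using this

/-- The derivative of the vorticity function on `[0, m]`. -/
noncomputable def dγ : ℝ → ℝ := derivWithin W.γ (Icc 0 W.m)

/-- The second derivative of the vorticity function on `[0, m]`. -/
noncomputable def ddγ : ℝ → ℝ := derivWithin W.dγ (Icc 0 W.m)

lemma hasDerivAt_γ {s : ℝ} (hs : s ∈ Ioo 0 W.m) : HasDerivAt W.γ (W.dγ s) s :=
  ((W.γ_smooth.differentiableOn (by norm_num)) s (Ioo_subset_Icc_self hs)).hasDerivWithinAt.hasDerivAt
    (Icc_mem_nhds hs.1 hs.2)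

lemma hasDerivAt_dγ {s : ℝ} (hs : s ∈ Ioo 0 W.m) : HasDerivAt W.dγ (W.ddγ s) s := by
  have h : ContDiffOn ℝ 1 W.dγ (Icc 0 W.m) :=
    W.γ_smooth.derivWithin (uniqueDiffOn_Icc W.m_pos) (by norm_num)
  exact ((h.differentiableOn (by norm_num)) s (Ioo_subset_Icc_self hs)).hasDerivWithinAt.hasDerivAt
    (Icc_mem_nhds hs.1 hs.2)

lemma eventually_x {x y : ℝ} (h2 : y < W.η x) : ∀ᶠ t in nhds x, y < W.η t :=
  W.η_smooth.continuous.continuousAt.eventually (lt_mem_nhds h2)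

lemma eventually_y {x y : ℝ} (h1 : -W.d < y) (h2 : y < W.η x) :
    ∀ᶠ t in nhds y, -W.d < t ∧ t < W.η x := Ioo_mem_nhds h1 h2

lemma laplace_u {x y : ℝ} (h1 : -W.d < y) (h2 : y < W.η x) :
    pdX (pdX W.u) (x, y) + pdY (pdY W.u) (x, y) = -(W.dγ (W.ψ (x, y)) * W.u (x, y)) := by
  have e1 : pdY (pdX W.v) (x, y)
      = pdY (pdY W.u) (x, y) + W.dγ (W.ψ (x, y)) * W.u (x, y) := by
    apply pdY_eq_of_eventuallyEq (h := fun t => pdY W.u (x, t) + W.γ (W.ψ (x, t)))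
      (W.contDiff_pdX_v.differentiable (by norm_num) _)
    · filter_upwards [W.eventually_y h1 h2] with t ht
      linarith [W.vorticity_eq x t ht.1 ht.2]
    · refine (pdY_hasDerivAt (W.contDiff_pdY_u.differentiable (by norm_num) _)).add ?_
      have := pdY_hasDerivAt (W.differentiable_ψ (x, y))
      rw [W.psi_y x y h1.le h2.le] at this
      exact (W.hasDerivAt_γ (W.psi_mem_Ioo h1 h2)).comp y this
  have e2 : pdX (pdX W.u) (x, y) = -pdX (pdY W.v) (x, y) := by
    apply pdX_eq_of_eventuallyEq (h := fun t => -pdY W.v (t, y))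
      (W.contDiff_pdX_u.differentiable (by norm_num) _)
    · filter_upwards [W.eventually_x h2] with t ht
      linarith [W.incompressible t y h1 ht]
    · exact (pdX_hasDerivAt (W.contDiff_pdY_v.differentiable (by norm_num) _)).neg
  rw [e2, pdX_pdY_comm (W.v_smooth.of_le (by norm_num)), e1]
  ring

lemma laplace_pdX_u {x y : ℝ} (h1 : -W.d < y) (h2 : y < W.η x) :
    pdX (pdX (pdX W.u)) (x, y) + pdY (pdY (pdX W.u)) (x, y)
      = W.ddγ (W.ψ (x, y)) * W.v (x, y) * W.u (x, y)
        - W.dγ (W.ψ (x, y)) * pdX W.u (x, y) := by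
  have c1 : pdX (pdY (pdY W.u)) = pdY (pdY (pdX W.u)) := by
    rw [pdX_pdY_comm W.contDiff_pdY_u, pdX_pdY_comm (W.u_smooth.of_le (by norm_num))]
  rw [← c1]
  have e : pdX (pdX (pdX W.u)) (x, y)
      = -(W.ddγ (W.ψ (x, y)) * (-W.v (x, y)) * W.u (x, y)
        + W.dγ (W.ψ (x, y)) * pdX W.u (x, y)) - pdX (pdY (pdY W.u)) (x, y) := by
    apply pdX_eq_of_eventuallyEq
      (h := fun t => -(W.dγ (W.ψ (t, y)) * W.u (t, y)) - pdY (pdY W.u) (t, y))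
      (W.contDiff_pdX_pdX_u.differentiable (by norm_num) _)
    · filter_upwards [W.eventually_x h2] with t ht
      linarith [W.laplace_u h1 ht]
    · have hψ := pdX_hasDerivAt (W.differentiable_ψ (x, y))
      rw [W.psi_x x y h1.le h2.le] at hψ
      exact (((W.hasDerivAt_dγ (W.psi_mem_Ioo h1 h2)).comp x hψ).mul
        (pdX_hasDerivAt (W.differentiable_u _))).neg.sub
        (pdX_hasDerivAt (W.contDiff_pdY_pdY_u.differentiable (by norm_num) _))
  rw [e]
  ring

/-! ### Relations up to the boundary -/

lemma continuous_slice {F : ℝ × ℝ → ℝ} (hF : Continuous F) (x : ℝ) :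
    Continuous fun y => F (x, y) := hF.comp (by fun_prop)

lemma incompressible_closure (hL : 0 < L) {x y : ℝ} (hy : y ∈ Icc (-W.d) (W.η x)) :
    pdX W.u (x, y) + pdY W.v (x, y) = 0 :=
  eq_zero_of_eq_zero_Ioo (F := fun y => pdX W.u (x, y) + pdY W.v (x, y))
    (continuous_slice (W.contDiff_pdX_u.continuous.add W.contDiff_pdY_v.continuous) x)
    (W.neg_d_lt_η hL x) (W.incompressible x) hy

lemma euler_x_closure (hL : 0 < L) {x y : ℝ} (hy : y ∈ Icc (-W.d) (W.η x)) :
    W.u (x, y) * pdX W.u (x, y) + W.v (x, y) * pdY W.u (x, y) + pdX W.P (x, y) = 0 := by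
  have hP : Continuous (pdX W.P) := (W.P_smooth.pdX (m := 2) (by norm_num)).continuous
  have h1 := W.u_smooth.continuous
  have h2 := W.v_smooth.continuous
  have h3 := W.contDiff_pdX_u.continuous
  have h4 := W.contDiff_pdY_u.continuous
  refine eq_zero_of_eq_zero_Ioo
    (F := fun y => W.u (x, y) * pdX W.u (x, y) + W.v (x, y) * pdY W.u (x, y) + pdX W.P (x, y))
    (by fun_prop) (W.neg_d_lt_η hL x) (fun t a b => ?_) hy
  linarith [W.euler_x x t a b]

lemma euler_y_closure (hL : 0 < L) {x y : ℝ} (hy : y ∈ Icc (-W.d) (W.η x)) :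
    W.u (x, y) * pdX W.v (x, y) + W.v (x, y) * pdY W.v (x, y) + pdY W.P (x, y) + g = 0 := by
  have hP : Continuous (pdY W.P) := (W.P_smooth.pdY (m := 2) (by norm_num)).continuous
  have h1 := W.u_smooth.continuous
  have h2 := W.v_smooth.continuous
  have h3 := W.contDiff_pdX_v.continuous
  have h4 := W.contDiff_pdY_v.continuous
  refine eq_zero_of_eq_zero_Ioo (F := fun y => W.u (x, y) * pdX W.v (x, y)
      + W.v (x, y) * pdY W.v (x, y) + pdY W.P (x, y) + g)
    (by fun_prop) (W.neg_d_lt_η hL x) (fun t a b => ?_) hy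
  linarith [W.euler_y x t a b]

lemma vorticity_surface (hL : 0 < L) (x : ℝ) :
    pdX W.v (x, W.η x) - pdY W.u (x, W.η x) = W.γ 0 := by
  have hlt := W.neg_d_lt_η hL x
  have h3 := W.contDiff_pdX_v.continuous
  have h4 := W.contDiff_pdY_u.continuous
  have hψ : Continuous fun y => W.ψ (x, y) := continuous_slice W.ψ_smooth.continuous x
  have key : EqOn (fun y => pdX W.v (x, y) - pdY W.u (x, y)) (fun y => W.γ (W.ψ (x, y)))
      (Icc (-W.d) (W.η x)) := by
    refine EqOn.of_subset_closure (s := Ioo (-W.d) (W.η x))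
      (fun y hy => W.vorticity_eq x y hy.1 hy.2) (by fun_prop)
      (W.γ_smooth.continuousOn.comp hψ.continuousOn (fun y hy => W.psi_mem_Icc hy.1 hy.2))
      Ioo_subset_Icc_self ?_
    rw [closure_Ioo hlt.ne]
  have := key (right_mem_Icc.2 hlt.le)
  simpa [W.psi_surface] using this

lemma laplace_u_nonpos_surface (hL : 0 < L)
    (hγ : ∀ s ∈ Icc (0 : ℝ) W.m, derivWithin W.γ (Icc 0 W.m) s ≤ 0) (x : ℝ) :
    pdX (pdX W.u) (x, W.η x) + pdY (pdY W.u) (x, W.η x) ≤ 0 := by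
  have hlt := W.neg_d_lt_η hL x
  have h3 := W.contDiff_pdX_pdX_u.continuous
  have h4 := W.contDiff_pdY_pdY_u.continuous
  have := nonneg_of_nonneg_Ioo (F := fun y => -(pdX (pdX W.u) (x, y) + pdY (pdY W.u) (x, y)))
    (by fun_prop) hlt (fun y a b => ?_) (right_mem_Icc.2 hlt.le)
  · linarith
  · rw [W.laplace_u a b, neg_neg]
    exact mul_nonneg_of_nonpos_of_nonpos (hγ _ (W.psi_mem_Icc a.le b.le)) (W.u_neg a.le b.le).le

/-- The tangential derivative of Bernoulli's law along the free surface. -/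
lemma bernoulli_tangential (hL : 0 < L) (x : ℝ) :
    (W.u (x, W.η x) ^ 2 - W.v (x, W.η x) ^ 2) * pdX W.u (x, W.η x)
      + 2 * W.u (x, W.η x) * W.v (x, W.η x) * pdY W.u (x, W.η x)
      + W.v (x, W.η x) * (g + W.γ 0 * W.u (x, W.η x)) = 0 := by
  have hm := right_mem_Icc.2 (W.neg_d_lt_η hL x).le
  have e1 := W.euler_x_closure hL hm
  have e2 := W.euler_y_closure hL hm
  have e3 := W.incompressible_closure hL hm
  have e4 := W.vorticity_surface hL x
  have e5 := W.surface_kinematic x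
  have e6 : pdX W.P (x, W.η x) + deriv W.η x * pdY W.P (x, W.η x) = 0 := by
    have h := pd_hasDerivAt_graph (W.differentiable_P _) (W.differentiable_η x).hasDerivAt
    exact h.unique ((hasDerivAt_const x Patm).congr_of_eventuallyEq
      (Filter.Eventually.of_forall W.surface_pressure))
  linear_combination W.u (x, W.η x) * e1 + W.v (x, W.η x) * e2 - W.v (x, W.η x) ^ 2 * e3
    - W.u (x, W.η x) * W.v (x, W.η x) * e4 - W.u (x, W.η x) * e6
    - pdY W.P (x, W.η x) * e5

lemma pdX_u_zero (y : ℝ) : pdX W.u (0, y) = 0 := by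
  have h1 := pdX_hasDerivAt (W.differentiable_u (0, y))
  have h2 := HasDerivAt.scomp_of_eq (h := fun t : ℝ => -t) (h' := -1) 0 h1 (hasDerivAt_neg 0)
    (by simp)
  have h3 : (fun t => W.u (t, y)) ∘ (fun t : ℝ => -t) = fun t => W.u (t, y) :=
    funext fun t => W.u_even t y
  rw [h3] at h2
  have := h1.unique h2
  simp at this
  linarith

lemma pdX_u_L (y : ℝ) : pdX W.u (L, y) = 0 := by
  have h1 := pdX_hasDerivAt (W.differentiable_u (L, y))
  have h2 := HasDerivAt.scomp_of_eq (h := fun t : ℝ => 2 * L - t) (h' := -1) L h1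
    ((hasDerivAt_id L).const_sub (2 * L)) (by ring)
  have h3 : (fun t => W.u (t, y)) ∘ (fun t : ℝ => 2 * L - t) = fun t => W.u (t, y) := by
    funext t
    have := W.u_periodic (-t) y
    rw [W.u_even] at this
    simpa [sub_eq_add_neg, add_comm] using this
  rw [h3] at h2
  have := h1.unique h2
  simp at this
  linarith

lemma pdX_u_bed_nonpos (hL : 0 < L) (hv : W.MonotoneHalf) {x : ℝ} (h0 : 0 < x) (h1 : x < L) :
    pdX W.u (x, -W.d) ≤ 0 := by
  have hlt := W.neg_d_lt_η hL x
  have := (pdY_hasDerivAt (W.differentiable_v (x, -W.d))).nonneg_of_le_right hlt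
    (fun t a b => by
      rw [W.bed_kinematic]
      exact (hv (x, t) (Or.inl ⟨h0, h1, a, b⟩)).le)
  linarith [W.incompressible_closure hL (left_mem_Icc.2 hlt.le)]

/-! ### The minimum principle for `u_x / u` -/

/-- The closure of the half period `Ω⁺` of the fluid domain. -/
def halfClosure : Set (ℝ × ℝ) :=
  {p | 0 ≤ p.1 ∧ p.1 ≤ L ∧ -W.d ≤ p.2 ∧ p.2 ≤ W.η p.1}

lemma isCompact_halfClosure : IsCompact W.halfClosure := by
  have hη : Continuous W.η := W.η_smooth.continuous
  obtain ⟨M, hM⟩ := (isCompact_Icc (a := (0 : ℝ)) (b := L)).bddAbove_image hη.continuousOn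
  refine (isCompact_Icc (a := ((0 : ℝ), -W.d)) (b := (L, M))).of_isClosed_subset ?_ ?_
  · exact (isClosed_le continuous_const continuous_fst).inter
      ((isClosed_le continuous_fst continuous_const).inter
        ((isClosed_le continuous_const continuous_snd).inter
          (isClosed_le continuous_snd (hη.comp continuous_fst))))
  · rintro ⟨x, y⟩ ⟨h1, h2, h3, h4⟩
    exact ⟨⟨h1, h3⟩, ⟨h2, h4.trans (hM ⟨x, ⟨h1, h2⟩, rfl⟩)⟩⟩

lemma continuousOn_ratio : ContinuousOn (fun p => pdX W.u p / W.u p) W.halfClosure :=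
  W.contDiff_pdX_u.continuous.continuousOn.div W.u_smooth.continuous.continuousOn
    (fun p hp => (W.u_neg (x := p.1) (y := p.2) hp.2.2.1 hp.2.2.2).ne)

lemma isOpen_Ωplus : IsOpen W.Ωplus := by
  have hη : Continuous W.η := W.η_smooth.continuous
  exact (isOpen_lt continuous_const continuous_fst).inter
    ((isOpen_lt continuous_fst continuous_const).inter
      ((isOpen_lt continuous_const continuous_snd).inter
        (isOpen_lt continuous_snd (hη.comp continuous_fst))))

/-- The perturbed ratio `u_x / u - ε e^{α x}` has no local minimum in `Ω⁺`. -/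
lemma no_interior_min (hv : W.MonotoneHalf)
    (hγ : ∀ s ∈ Icc (0 : ℝ) W.m, W.ddγ s ≤ 0)
    {x y ε C : ℝ} (hε : 0 < ε) (hp : (x, y) ∈ W.Ωplus)
    (hC : |pdX W.u (x, y) / W.u (x, y)| ≤ C)
    (hmin : ∀ᶠ q in nhds (x, y), pdX W.u (x, y) / W.u (x, y) - ε * Real.exp ((2 * C + 1) * x)
      ≤ pdX W.u q / W.u q - ε * Real.exp ((2 * C + 1) * q.1)) : False := by
  obtain ⟨hx0, hxL, hy1, hy2⟩ := hp
  simp only at hx0 hxL hy1 hy2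
  have hC0 : 0 ≤ C := (abs_nonneg _).trans hC
  obtain ⟨α, hα⟩ : ∃ α, α = 2 * C + 1 := ⟨_, rfl⟩
  rw [← hα] at hmin
  obtain ⟨c, hc⟩ : ∃ c, c = pdX W.u (x, y) / W.u (x, y) - ε * Real.exp (α * x) := ⟨_, rfl⟩
  rw [← hc] at hmin
  have hu : W.u (x, y) < 0 := W.u_neg hy1.le hy2.le
  have hux : pdX W.u (x, y) = (ε * Real.exp (α * x) + c) * W.u (x, y) := by
    rw [hc, add_sub_cancel, div_mul_cancel₀ _ hu.ne]
  have hle : ∀ᶠ q in nhds (x, y), pdX W.u q - (ε * Real.exp (α * q.1) + c) * W.u q ≤ 0 := by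
    filter_upwards [hmin, W.isOpen_Ωplus.mem_nhds ⟨hx0, hxL, hy1, hy2⟩] with q h1 h2
    have hq : W.u q < 0 := W.u_neg (x := q.1) (y := q.2) h2.2.2.1.le h2.2.2.2.le
    have h3 : ε * Real.exp (α * q.1) + c ≤ pdX W.u q / W.u q := by linarith
    rw [le_div_iff_of_neg hq] at h3
    linarith
  have hexp : ∀ t : ℝ, HasDerivAt (fun t => ε * Real.exp (α * t)) (ε * (Real.exp (α * t) * α)) t :=
    fun t => (((hasDerivAt_id t).const_mul α).exp.const_mul ε).congr_deriv (by simp)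
  have hexp' : ∀ t : ℝ, HasDerivAt (fun t => ε * (Real.exp (α * t) * α))
      (ε * (Real.exp (α * t) * α * α)) t := fun t =>
    ((((hasDerivAt_id t).const_mul α).exp.mul_const α).const_mul ε).congr_deriv (by simp)
  have du := W.differentiable_u
  have dux : Differentiable ℝ (pdX W.u) := W.contDiff_pdX_u.differentiable (by norm_num)
  have duy : Differentiable ℝ (pdY W.u) := W.contDiff_pdY_u.differentiable (by norm_num)
  have duxx : Differentiable ℝ (pdX (pdX W.u)) := W.contDiff_pdX_pdX_u.differentiable (by norm_num)
  have duxy : Differentiable ℝ (pdY (pdX W.u)) := W.contDiff_pdY_pdX_u.differentiable (by norm_num)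
  have hmx : IsLocalMax
      (fun t => pdX W.u (t, y) - (ε * Real.exp (α * t) + c) * W.u (t, y)) x := by
    have hcont : Filter.Tendsto (fun t : ℝ => (t, y)) (nhds x) (nhds (x, y)) :=
      Continuous.tendsto (by fun_prop) x
    filter_upwards [hcont.eventually hle] with t ht
    rw [hux, sub_self]
    exact ht
  have hmy : IsLocalMax
      (fun t => pdX W.u (x, t) - (ε * Real.exp (α * x) + c) * W.u (x, t)) y := by
    have hcont : Filter.Tendsto (fun t : ℝ => (x, t)) (nhds y) (nhds (x, y)) :=
      Continuous.tendsto (by fun_prop) y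
    filter_upwards [hcont.eventually hle] with t ht
    rw [hux, sub_self]
    exact ht
  have hxx := hmx.second_deriv_nonpos
    (fun t => (pdX_hasDerivAt (dux _)).sub (((hexp t).add_const c).mul (pdX_hasDerivAt (du _))))
    ((pdX_hasDerivAt (duxx _)).sub
      (((hexp' x).mul (pdX_hasDerivAt (du _))).add
        (((hexp x).add_const c).mul (pdX_hasDerivAt (dux _)))))
  have hyy := hmy.second_deriv_nonpos
    (fun t => (pdY_hasDerivAt (dux _)).sub
      ((pdY_hasDerivAt (du _)).const_mul (ε * Real.exp (α * x) + c)))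
    ((pdY_hasDerivAt (duxy _)).sub
      ((pdY_hasDerivAt (duy _)).const_mul (ε * Real.exp (α * x) + c)))
  have l1 := W.laplace_u hy1 hy2
  have l2 := W.laplace_pdX_u hy1 hy2
  have hφ : -C ≤ ε * Real.exp (α * x) + c := by
    have := neg_le_of_abs_le hC
    linarith
  have hs := hγ _ (W.psi_mem_Icc hy1.le hy2.le)
  have hvp := hv (x, y) (Or.inl ⟨hx0, hxL, hy1, hy2⟩)
  have hE : 0 < Real.exp (α * x) := Real.exp_pos _
  have hα0 : 0 < α := by linarith
  have k1 : 0 < ε * Real.exp (α * x) * α * (2 * (ε * Real.exp (α * x) + c) + α) :=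
    mul_pos (by positivity) (by linarith)
  have k2 := mul_neg_of_pos_of_neg k1 hu
  have k3 : 0 ≤ W.ddγ (W.ψ (x, y)) * W.v (x, y) * W.u (x, y) :=
    mul_nonneg_of_nonpos_of_nonpos (mul_nonpos_of_nonpos_of_nonneg hs hvp.le) hu.le
  have k4 : W.ddγ (W.ψ (x, y)) * W.v (x, y) * W.u (x, y)
      - ε * Real.exp (α * x) * α * (2 * (ε * Real.exp (α * x) + c) + α) * W.u (x, y) ≤ 0 := by
    refine le_of_eq_of_le ?_ (add_nonpos hxx hyy)
    linear_combination -l2 + (ε * Real.exp (α * x) + c) * l1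
      + (2 * ε * Real.exp (α * x) * α + W.dγ (W.ψ (x, y))) * hux
  linarith

/-- Minimum principle: a nonpositive lower bound of `u_x / u` on the free surface is a lower
bound on the whole closed half period. -/
lemma le_ratio_of_le_surface (hL : 0 < L) (hv : W.MonotoneHalf)
    (hγ : ∀ s ∈ Icc (0 : ℝ) W.m, W.ddγ s ≤ 0) {μ : ℝ} (hμ : μ ≤ 0)
    (hS : ∀ x ∈ Icc 0 L, μ ≤ pdX W.u (x, W.η x) / W.u (x, W.η x))
    {q : ℝ × ℝ} (hq : q ∈ W.halfClosure) : μ ≤ pdX W.u q / W.u q := by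
  obtain ⟨C, hC⟩ := W.isCompact_halfClosure.exists_bound_of_continuousOn W.continuousOn_ratio
  have hC0 : 0 ≤ C := (norm_nonneg _).trans (hC q hq)
  refine le_of_forall_pos_le_add fun δ hδ => ?_
  obtain ⟨ε, hε⟩ : ∃ ε, ε = δ / Real.exp ((2 * C + 1) * L) := ⟨_, rfl⟩
  have hε0 : 0 < ε := hε ▸ div_pos hδ (Real.exp_pos _)
  have hεδ : ε * Real.exp ((2 * C + 1) * L) = δ := by
    rw [hε]
    field_simp
  obtain ⟨⟨x, y⟩, hp, hmin⟩ := W.isCompact_halfClosure.exists_isMinOn ⟨q, hq⟩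
    (f := fun p => pdX W.u p / W.u p - ε * Real.exp ((2 * C + 1) * p.1))
    (W.continuousOn_ratio.sub (by fun_prop))
  have hpq : pdX W.u (x, y) / W.u (x, y) - ε * Real.exp ((2 * C + 1) * x)
      ≤ pdX W.u q / W.u q - ε * Real.exp ((2 * C + 1) * q.1) := hmin hq
  have hpos : 0 < ε * Real.exp ((2 * C + 1) * q.1) := by positivity
  obtain ⟨h0, h1, h2, h3⟩ := id hp
  simp only at h0 h1 h2 h3
  have hx : ε * Real.exp ((2 * C + 1) * x) ≤ δ := by
    rw [← hεδ]
    gcongr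
  suffices h : μ ≤ pdX W.u (x, y) / W.u (x, y) by linarith
  rcases h0.eq_or_lt with rfl | h0
  · simpa [W.pdX_u_zero] using hμ
  rcases h1.eq_or_lt with rfl | h1
  · simpa [W.pdX_u_L] using hμ
  rcases h3.eq_or_lt with rfl | h3
  · exact hS x ⟨h0.le, h1.le⟩
  rcases h2.eq_or_lt with rfl | h2
  · exact hμ.trans (div_nonneg_of_nonpos (W.pdX_u_bed_nonpos hL hv h0 h1)
      (W.u_neg le_rfl h3.le).le)
  refine (W.no_interior_min hv hγ hε0 ⟨h0, h1, h2, h3⟩ (hC _ hp) ?_).elim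
  filter_upwards [W.isOpen_Ωplus.mem_nhds ⟨h0, h1, h2, h3⟩] with r hr
  exact hmin ⟨hr.1.le, hr.2.1.le, hr.2.2.1.le, hr.2.2.2.le⟩

/-- The inequality satisfied at an interior surface minimum of `u_x / u`. -/
lemma ineq_of_surface_min (hg : 0 < g) (hL : 0 < L) (hMW : W.MemW) {x : ℝ}
    (hv : 0 < W.v (x, W.η x)) (ha : 0 < pdX W.u (x, W.η x))
    (hT : IsLocalMin (fun t => pdX W.u (t, W.η t) / W.u (t, W.η t)) x)
    (hN : ∀ y, -W.d < y → y < W.η x →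
      pdX W.u (x, W.η x) / W.u (x, W.η x) ≤ pdX W.u (x, y) / W.u (x, y)) :
    g * ((W.u (x, W.η x)) ^ 4 - 4 * (W.u (x, W.η x)) ^ 2 * (W.v (x, W.η x)) ^ 2
          - (W.v (x, W.η x)) ^ 4)
        - W.γ 0 * (W.u (x, W.η x)) ^ 3
          * ((W.u (x, W.η x)) ^ 2 + 5 * (W.v (x, W.η x)) ^ 2) < 0 := by
  have hlt := W.neg_d_lt_η hL x
  have hu : W.u (x, W.η x) < 0 := W.u_neg hlt.le le_rfl
  have dux : Differentiable ℝ (pdX W.u) := W.contDiff_pdX_u.differentiable (by norm_num)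
  have duy : Differentiable ℝ (pdY W.u) := W.contDiff_pdY_u.differentiable (by norm_num)
  have hη := (W.differentiable_η x).hasDerivAt
  have Hu := pd_hasDerivAt_graph (W.differentiable_u (x, W.η x)) hη
  have Hv := pd_hasDerivAt_graph (W.differentiable_v (x, W.η x)) hη
  have Ha := pd_hasDerivAt_graph (dux (x, W.η x)) hη
  have Hb := pd_hasDerivAt_graph (duy (x, W.η x)) hη
  rw [pdX_pdY_comm (W.u_smooth.of_le (by norm_num))] at Hb
  have hvp := W.surface_kinematic x
  have i1 := W.incompressible_closure hL (right_mem_Icc.2 hlt.le)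
  have i2 := W.vorticity_surface hL x
  have tang := hT.hasDerivAt_eq_zero (Ha.div Hu hu.ne)
  rw [div_eq_zero_iff, or_iff_left (pow_ne_zero 2 hu.ne)] at tang
  have norm := ((pdY_hasDerivAt (dux (x, W.η x))).div
    (pdY_hasDerivAt (W.differentiable_u (x, W.η x))) hu.ne).nonpos_of_le_left hlt hN
  have hu2 : 0 < W.u (x, W.η x) ^ 2 := sq_pos_of_neg hu
  rw [div_le_iff₀ hu2, zero_mul] at norm
  have bern := ((((Hu.pow 2).sub (Hv.pow 2)).mul Ha).add (((Hu.const_mul 2).mul Hv).mul Hb)).add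
    (Hv.mul ((Hu.const_mul (W.γ 0)).const_add g))
  have bern0 := bern.unique ((hasDerivAt_const x (0 : ℝ)).congr_of_eventuallyEq
    (Filter.Eventually.of_forall (W.bernoulli_tangential hL)))
  refine surface_algebra hg (hMW.1 0 (left_mem_Icc.2 W.m_pos.le)) hu hv ha
    (W.bernoulli_tangential hL x)
    (A := pdX (pdX W.u) (x, W.η x)) (B := pdY (pdX W.u) (x, W.η x))
    (C := pdY (pdY W.u) (x, W.η x)) ?_ ?_ ?_ (W.laplace_u_nonpos_surface hL hMW.2.1 x)
  · rw [hvp]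
    linear_combination W.u (x, W.η x) * tang
  · have i1' : pdY W.v (x, W.η x) = -pdX W.u (x, W.η x) := by linarith
    have i2' : pdX W.v (x, W.η x) = pdY W.u (x, W.η x) + W.γ 0 := by linarith
    simp only [Pi.sub_apply, Pi.pow_apply, Pi.mul_apply, i1', i2',
      Nat.cast_ofNat, Nat.add_one_sub_one, pow_one] at bern0
    rw [hvp] at bern0 ⊢
    linear_combination W.u (x, W.η x) * bern0
  · linarith

end PeriodicWave

/-- **Lemma (bounds along `S⁺` for waves outside `𝒲₀`).**  For every nontrivial periodic
wave in `𝒲 \ 𝒲₀` (that is, with `u_x > 0` somewhere on `S⁺`), the infimum over `Ω⁺` of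
`u_x/u` is strictly negative and attained at some point `z₀ = (x₀, η x₀) ∈ S⁺`, where
moreover `g(u⁴ − 4u²v² − v⁴) − γ(0)·u³(u² + 5v²) < 0`. -/
theorem periodic_inf_attained_on_surface (g Patm L : ℝ) (hg : 0 < g) (hL : 0 < L)
    (W : PeriodicWave g Patm L) (hMW : W.MemW) (hnt : ¬W.IsTrivial)
    (hux : ∃ x, 0 < x ∧ x < L ∧ 0 < pdX W.u (x, W.η x)) :
    ∃ x₀, 0 < x₀ ∧ x₀ < L ∧
      pdX W.u (x₀, W.η x₀) / W.u (x₀, W.η x₀) < 0 ∧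
      IsGLB ((fun p => pdX W.u p / W.u p) '' W.Ωplus)
        (pdX W.u (x₀, W.η x₀) / W.u (x₀, W.η x₀)) ∧
      g * ((W.u (x₀, W.η x₀)) ^ 4 - 4 * (W.u (x₀, W.η x₀)) ^ 2 * (W.v (x₀, W.η x₀)) ^ 2
          - (W.v (x₀, W.η x₀)) ^ 4)
        - W.γ 0 * (W.u (x₀, W.η x₀)) ^ 3
          * ((W.u (x₀, W.η x₀)) ^ 2 + 5 * (W.v (x₀, W.η x₀)) ^ 2) < 0 := by
  have hv : W.MonotoneHalf := hMW.2.2.2.resolve_left hnt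
  have hγ : ∀ s ∈ Icc (0 : ℝ) W.m, W.ddγ s ≤ 0 := hMW.2.2.1
  have hgraph : Continuous fun t => (t, W.η t) := by
    have := W.η_smooth.continuous
    fun_prop
  have hu : ∀ t, W.u (t, W.η t) < 0 := fun t => W.u_neg (W.neg_d_lt_η hL t).le le_rfl
  have hcont : Continuous fun t => pdX W.u (t, W.η t) / W.u (t, W.η t) :=
    (W.contDiff_pdX_u.continuous.comp hgraph).div (W.u_smooth.continuous.comp hgraph)
      (fun t => (hu t).ne)
  obtain ⟨x₀, hx₀, hmin⟩ := (isCompact_Icc (a := (0 : ℝ)) (b := L)).exists_isMinOn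
    (nonempty_Icc.2 hL.le) hcont.continuousOn
  obtain ⟨x₁, h0, h1, hpos⟩ := hux
  have hneg : pdX W.u (x₀, W.η x₀) / W.u (x₀, W.η x₀) < 0 :=
    (hmin ⟨h0.le, h1.le⟩ : _ ≤ pdX W.u (x₁, W.η x₁) / W.u (x₁, W.η x₁)).trans_lt
      (div_neg_of_pos_of_neg hpos (hu x₁))
  have hx0 : 0 < x₀ := by
    refine lt_of_le_of_ne hx₀.1 ?_
    rintro rfl
    simp [W.pdX_u_zero] at hneg
  have hxL : x₀ < L := by
    refine lt_of_le_of_ne hx₀.2 ?_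
    rintro rfl
    simp [W.pdX_u_L] at hneg
  have hlt := W.neg_d_lt_η hL x₀
  have hglobal : ∀ q ∈ W.Ωplus,
      pdX W.u (x₀, W.η x₀) / W.u (x₀, W.η x₀) ≤ pdX W.u q / W.u q := fun q hq =>
    W.le_ratio_of_le_surface hL hv hγ hneg.le (fun t ht => hmin ht)
      ⟨hq.1.le, hq.2.1.le, hq.2.2.1.le, hq.2.2.2.le⟩
  refine ⟨x₀, hx0, hxL, hneg, ⟨?_, ?_⟩, ?_⟩
  · rintro _ ⟨q, hq, rfl⟩
    exact hglobal q hq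
  · intro b hb
    have hslice : ContinuousAt (fun y => pdX W.u (x₀, y) / W.u (x₀, y)) (W.η x₀) :=
      (PeriodicWave.continuous_slice W.contDiff_pdX_u.continuous x₀).continuousAt.div
        (PeriodicWave.continuous_slice W.u_smooth.continuous x₀).continuousAt (hu x₀).ne
    refine ge_of_tendsto (hslice.tendsto.mono_left (nhdsWithin_le_nhds (s := Iio (W.η x₀)))) ?_
    filter_upwards [Ioo_mem_nhdsLT hlt] with y hy
    exact hb ⟨(x₀, y), ⟨hx0, hxL, hy.1, hy.2⟩, rfl⟩
  · refine W.ineq_of_surface_min hg hL hMW (hv _ (Or.inr ⟨hx0, hxL, rfl⟩)) ?_ ?_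
      (fun y a b => hglobal (x₀, y) ⟨hx0, hxL, a, b⟩)
    · by_contra! hcon
      exact hneg.not_ge (div_nonneg_of_nonpos hcon (hu x₀).le)
    · exact hmin.isLocalMin (Icc_mem_nhds hx0 hxL)
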